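/- arXiv:1510.05466 — 13 statements merged into one kernel-verified Lean document; each statement's English description precedes it below -/
import Mathlib

section
/- Let X and Y be finite sets, c : X × Y → ℝ a cost function, N ⊆ X × Y a neighbourhood, π a coupling with spt π ⊆ N, and (α, β) a dual pair that is locally feasible with respect to N and tight on π. If for a pair (x₁, yₙ) ∈ X × Y there exists a short-cut ((x₂,y₂),…,(x_{n−1},y_{n−1})) within N, then the dual constraint corresponding to (x₁,yₙ) is satisfied, i.e. α(x₁) + β(yₙ) ≤ c(x₁,yₙ). -/
/-- **Proposition (Short-cuts imply dual constraints).**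
If `(π, (α, β))` are local primal/dual data w.r.t. a neighbourhood `N ⊇ spt π`
(`(α, β)` locally feasible on `N` and tight on `spt π`), and the tuple
`((x₂,y₂), …, (x_{n-1},y_{n-1}))` is a short-cut for `(x₁, yₙ)`, then the dual
constraint `α(x₁) + β(yₙ) ≤ c(x₁, yₙ)` holds. -/
theorem shortcut_implies_dual_constraint
    {X Y : Type*} [Fintype X] [Fintype Y]
    (c : X → Y → ℝ) (N : Set (X × Y))
    (μ : X → ℝ) (ν : Y → ℝ)
    (hμ1 : ∑ x, μ x = 1) (hν1 : ∑ y, ν y = 1)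
    (π : X → Y → ℝ)
    (hπ0 : ∀ x y, 0 ≤ π x y)
    (hπμ : ∀ x, ∑ y, π x y = μ x)
    (hπν : ∀ y, ∑ x, π x y = ν y)
    (hsub : ∀ x y, 0 < π x y → (x, y) ∈ N)
    (α : X → ℝ) (β : Y → ℝ)
    (hfeas : ∀ x y, (x, y) ∈ N → α x + β y ≤ c x y)
    (htight : ∀ x y, 0 < π x y → α x + β y = c x y)
    (n : ℕ) (hn : 2 ≤ n)
    (x : ℕ → X) (y : ℕ → Y)
    (hspt : ∀ i, 2 ≤ i → i ≤ n - 1 → 0 < π (x i) (y i))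
    (hN : ∀ i, 1 ≤ i → i ≤ n - 1 → (x i, y (i + 1)) ∈ N)
    (hcost : c (x 1) (y n) ≥
      c (x 1) (y 2) + ∑ i ∈ Finset.Icc 2 (n - 1), (c (x i) (y (i + 1)) - c (x i) (y i))) :
    α (x 1) + β (y n) ≤ c (x 1) (y n) := by
  have hIcc : Finset.Icc 2 (n - 1) = Finset.Ico 2 n := by
    ext i
    simp only [Finset.mem_Icc, Finset.mem_Ico]
    omega
  have htele : ∑ i ∈ Finset.Ico 2 n, (β (y (i + 1)) - β (y i)) = β (y n) - β (y 2) :=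
    Finset.sum_Ico_sub (fun i => β (y i)) hn
  have hstep : ∑ i ∈ Finset.Ico 2 n, (β (y (i + 1)) - β (y i)) ≤
      ∑ i ∈ Finset.Ico 2 n, (c (x i) (y (i + 1)) - c (x i) (y i)) := by
    refine Finset.sum_le_sum fun i hi => ?_
    rw [Finset.mem_Ico] at hi
    have h₁ := hfeas _ _ (hN i (by omega) (by omega))
    have h₂ := htight _ _ (hspt i hi.1 (by omega))
    linarith
  have hfirst := hfeas _ _ (hN 1 le_rfl (by omega))
  norm_num at hfirst
  rw [hIcc] at hcost
  linarith
end

section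
/- Let X and Y be finite sets, c : X × Y → ℝ a cost function, π a coupling, N ⊆ X × Y a neighbourhood with spt π ⊆ N, and (x₁, yₙ) ∈ X × Y. Let ((x₂,y₂),…,(x_{n−1},y_{n−1})) be an ordered tuple of pairs in spt π such that (x_i,y_{i+1}) ∈ N for i = 1,…,n−1 and (x_{i+1},y_{i+1}) shields x_i from yₙ for i = 1,…,n−2. Then c(x₁,yₙ) > Σ_{i=1}^{n−2}[c(x_i,y_{i+1}) − c(x_{i+1},y_{i+1})] + c(x_{n−1},yₙ); in particular c(x₁,yₙ) ≥ c(x₁,y₂) + Σ_{i=2}^{n−1}[c(x_i,y_{i+1}) − c(x_i,y_i)], so the tuple is a short-cut for (x₁,yₙ). -/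
theorem sum_Icc_sub_succ_add_eq (f g : ℕ → ℝ) (m : ℕ) :
    (∑ i ∈ Finset.Icc 1 (m + 1), (f i - g (i + 1))) + f (m + 2) =
      f 1 + ∑ i ∈ Finset.Icc 2 (m + 2), (f i - g i) := by
  induction m with
  | zero => simp; ring
  | succ m ih =>
    rw [Finset.sum_Icc_succ_top (by omega : 1 ≤ m + 1 + 1),
      show m + 1 + 2 = m + 2 + 1 by ring,
      Finset.sum_Icc_succ_top (by omega : 2 ≤ m + 2 + 1)]
    linear_combination ih

theorem sum_Icc_one_sub_succ (a : ℕ → ℝ) (m : ℕ) :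
    ∑ i ∈ Finset.Icc 1 m, (a i - a (i + 1)) = a 1 - a (m + 1) := by
  induction m with
  | zero => simp
  | succ m ih =>
    rw [Finset.sum_Icc_succ_top (by omega : 1 ≤ m + 1)]
    linear_combination ih

/-- **Proposition (Shielding implies short-cut).**
If `((x₂,y₂), …, (x_{n-1},y_{n-1}))` is an ordered tuple of pairs in `spt π` with
`(x_i, y_{i+1}) ∈ N` for `i = 1, …, n-1` and such that `(x_{i+1}, y_{i+1})` shields `x_i`
from `yₙ` for `i = 1, …, n-2`, then
`c(x₁,yₙ) > Σ_{i=1}^{n-2}[c(x_i,y_{i+1}) − c(x_{i+1},y_{i+1})] + c(x_{n-1},yₙ)`,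
and in particular the tuple is a short-cut for `(x₁, yₙ)`:
`c(x₁,yₙ) ≥ c(x₁,y₂) + Σ_{i=2}^{n-1}[c(x_i,y_{i+1}) − c(x_i,y_i)]`. -/
theorem shielding_tuple_is_shortcut
    {X Y : Type*} [Fintype X] [Fintype Y]
    (c : X → Y → ℝ) (N : Set (X × Y))
    (π : X → Y → ℝ)
    (hπ0 : ∀ x y, 0 ≤ π x y)
    (hπ1 : ∑ x, ∑ y, π x y = 1)
    (hsub : ∀ x y, 0 < π x y → (x, y) ∈ N)
    (n : ℕ) (hn : 3 ≤ n)
    (x : ℕ → X) (y : ℕ → Y)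
    (hspt : ∀ i, 2 ≤ i → i ≤ n - 1 → 0 < π (x i) (y i))
    (hN : ∀ i, 1 ≤ i → i ≤ n - 1 → (x i, y (i + 1)) ∈ N)
    (hshield : ∀ i, 1 ≤ i → i ≤ n - 2 →
      c (x i) (y n) - c (x (i + 1)) (y n) >
        c (x i) (y (i + 1)) - c (x (i + 1)) (y (i + 1))) :
    c (x 1) (y n) >
      (∑ i ∈ Finset.Icc 1 (n - 2), (c (x i) (y (i + 1)) - c (x (i + 1)) (y (i + 1)))) +
        c (x (n - 1)) (y n)
    ∧ c (x 1) (y n) ≥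
      c (x 1) (y 2) + ∑ i ∈ Finset.Icc 2 (n - 1), (c (x i) (y (i + 1)) - c (x i) (y i)) := by
  obtain ⟨m, rfl⟩ := Nat.exists_eq_add_of_le' hn
  rw [show m + 3 - 2 = m + 1 by omega] at *
  rw [show m + 3 - 1 = m + 2 by omega] at *
  have hlt : ∑ i ∈ Finset.Icc 1 (m + 1), (c (x i) (y (i + 1)) - c (x (i + 1)) (y (i + 1))) <
      ∑ i ∈ Finset.Icc 1 (m + 1), (c (x i) (y (m + 3)) - c (x (i + 1)) (y (m + 3))) :=
    Finset.sum_lt_sum_of_nonempty ⟨1, by simp⟩ fun i hi =>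
      hshield i (Finset.mem_Icc.1 hi).1 (Finset.mem_Icc.1 hi).2
  rw [sum_Icc_one_sub_succ (fun i => c (x i) (y (m + 3))) (m + 1)] at hlt
  have hre := sum_Icc_sub_succ_add_eq (fun i => c (x i) (y (i + 1)))
    (fun i => c (x i) (y i)) m
  constructor <;> linarith
end

section
/- Let X and Y be finite sets, c : X × Y → ℝ a cost function, N ⊆ X × Y, π a coupling with spt π ⊆ N, and (α, β) a dual pair that is locally feasible with respect to N and tight on π. Then for every cyclic sequence of pairs (x_i,y_i), (x_{i+1},y_{i+1}), …, (x_k,y_k) in spt π with (x_j,y_{j+1}) ∈ N for j = i,…,k−1 and (x_k,y_k) = (x_i,y_i), one has Σ_{j=i}^{k−1}[c(x_j,y_{j+1}) − c(x_{j+1},y_{j+1})] ≥ 0. Consequently, there is no such cyclic sequence in which, for some fixed y_B ∈ Y, the pair (x_{j+1},y_{j+1}) shields x_j from y_B for every j = i,…,k−1. -/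
/-- **No cycles in the short-cut construction.**
Given local primal/dual data `(π, (α, β))` w.r.t. `N` (locally feasible on `N`, tight on
`spt π`), any cyclic sequence `(x_i,y_i), …, (x_k,y_k)` in `spt π` with
`(x_j, y_{j+1}) ∈ N` for `j = i, …, k-1` and `(x_k,y_k) = (x_i,y_i)` satisfies
`Σ_{j=i}^{k-1}[c(x_j,y_{j+1}) − c(x_{j+1},y_{j+1})] ≥ 0`, and consequently for no
`y_B ∈ Y` can `(x_{j+1},y_{j+1})` shield `x_j` from `y_B` for every `j = i, …, k-1`. -/
theorem no_shielding_cycle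
    {X Y : Type*} [Fintype X] [Fintype Y]
    (c : X → Y → ℝ) (N : Set (X × Y))
    (π : X → Y → ℝ)
    (hπ0 : ∀ x y, 0 ≤ π x y)
    (hπ1 : ∑ x, ∑ y, π x y = 1)
    (hsub : ∀ x y, 0 < π x y → (x, y) ∈ N)
    (α : X → ℝ) (β : Y → ℝ)
    (hfeas : ∀ x y, (x, y) ∈ N → α x + β y ≤ c x y)
    (htight : ∀ x y, 0 < π x y → α x + β y = c x y)
    (i k : ℕ) (hik : i < k)
    (x : ℕ → X) (y : ℕ → Y)
    (hspt : ∀ j, i ≤ j → j ≤ k → 0 < π (x j) (y j))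
    (hN : ∀ j, i ≤ j → j < k → (x j, y (j + 1)) ∈ N)
    (hcycx : x k = x i) (hcycy : y k = y i) :
    0 ≤ ∑ j ∈ Finset.Ico i k, (c (x j) (y (j + 1)) - c (x (j + 1)) (y (j + 1)))
    ∧ ∀ yB : Y, ¬ (∀ j, i ≤ j → j < k →
        c (x j) yB - c (x (j + 1)) yB >
          c (x j) (y (j + 1)) - c (x (j + 1)) (y (j + 1))) := by
  have htele (f : X → ℝ) : ∑ j ∈ Finset.Ico i k, (f (x j) - f (x (j + 1))) = 0 := by
    rw [← neg_eq_zero, ← Finset.sum_neg_distrib]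
    simp_rw [neg_sub]
    rw [Finset.sum_Ico_sub (fun j => f (x j)) hik.le, hcycx, sub_self]
  have hsum : 0 ≤ ∑ j ∈ Finset.Ico i k, (c (x j) (y (j + 1)) - c (x (j + 1)) (y (j + 1))) := by
    rw [← htele α]
    refine Finset.sum_le_sum fun j hj => ?_
    obtain ⟨hij, hjk⟩ := Finset.mem_Ico.mp hj
    linarith [hfeas _ _ (hN j hij hjk), htight _ _ (hspt (j + 1) (by omega) hjk)]
  refine ⟨hsum, fun yB hshield => hsum.not_gt ?_⟩
  rw [← htele fun z => c z yB]
  refine Finset.sum_lt_sum_of_nonempty (Finset.nonempty_Ico.mpr hik) fun j hj => ?_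
  obtain ⟨hij, hjk⟩ := Finset.mem_Ico.mp hj
  exact hshield j hij hjk
end

section
/- Let X and Y be finite sets, c : X × Y → ℝ a cost function, π a coupling, and N ⊆ X × Y a shielding neighbourhood for π. Suppose there exists a dual pair (α, β) that is locally feasible with respect to N and tight on π. Then for every pair (x_A, y_B) ∈ (X × Y) \ N there exists a short-cut for (x_A, y_B) within N. -/
/-- Induction on a finite type along the strict order induced by a real-valued function. -/
theorem Finite.induction_of_potential {X : Type*} [Finite X] (f : X → ℝ) {P : X → Prop}
    (step : ∀ x, (∀ x', f x' < f x → P x') → P x) (x : X) : P x := by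
  let : Preorder X := Preorder.lift f
  exact (wellFounded_lt (α := X)).induction x step

/-- The length of a chain with `n + 1` steps splits into its first link and the shifted remainder. -/
theorem sum_Icc_links_succ {X Y : Type*} (c : X → Y → ℝ) (n : ℕ) (hn : 2 ≤ n)
    (x : ℕ → X) (y : ℕ → Y) :
    ∑ i ∈ Finset.Icc 2 (n + 1 - 1), (c (x i) (y (i + 1)) - c (x i) (y i)) =
      (c (x 2) (y 3) - c (x 2) (y 2)) +
        ∑ i ∈ Finset.Icc 2 (n - 1),
          (c (x (i + 1)) (y (i + 2)) - c (x (i + 1)) (y (i + 1))) := by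
  obtain ⟨m, rfl⟩ := Nat.exists_eq_add_of_le' hn
  have e (k : ℕ) : Finset.Icc 2 k = Finset.Ico 2 (k + 1) := by ext; simp
  rw [e, e, Finset.sum_eq_sum_Ico_succ_bot (by omega)]
  congr 1
  exact (Finset.sum_Ico_add' (fun i => c (x i) (y (i + 1)) - c (x i) (y i)) 2 (m + 2) 1).symm

/-- **Proposition (Existence of short-cuts).**
Let `N` be a shielding neighbourhood for a coupling `π`, and suppose there is a dual pair
`(α, β)` locally feasible w.r.t. `N` and tight on `π`. Then for every pair
`(x_A, y_B) ∈ (X × Y) \ N` there exists a short-cut for `(x_A, y_B)` within `N`. -/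
theorem shielding_neighbourhood_has_shortcuts
    {X Y : Type*} [Fintype X] [Fintype Y]
    (c : X → Y → ℝ) (N : Set (X × Y))
    (π : X → Y → ℝ)
    (hπ0 : ∀ x y, 0 ≤ π x y)
    (hπ1 : ∑ x, ∑ y, π x y = 1)
    (hsub : ∀ x y, 0 < π x y → (x, y) ∈ N)
    (hshield : ∀ xA yB, (xA, yB) ∈ N ∨
      ∃ xs ys, 0 < π xs ys ∧ (xA, ys) ∈ N ∧
        c xA yB - c xs yB > c xA ys - c xs ys)
    (α : X → ℝ) (β : Y → ℝ)
    (hfeas : ∀ x y, (x, y) ∈ N → α x + β y ≤ c x y)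
    (htight : ∀ x y, 0 < π x y → α x + β y = c x y) :
    ∀ xA yB, (xA, yB) ∉ N →
      ∃ (n : ℕ) (x : ℕ → X) (y : ℕ → Y), 2 ≤ n ∧ x 1 = xA ∧ y n = yB ∧
        (∀ i, 2 ≤ i → i ≤ n - 1 → 0 < π (x i) (y i)) ∧
        (∀ i, 1 ≤ i → i ≤ n - 1 → (x i, y (i + 1)) ∈ N) ∧
        c (x 1) (y n) ≥
          c (x 1) (y 2) + ∑ i ∈ Finset.Icc 2 (n - 1), (c (x i) (y (i + 1)) - c (x i) (y i)) := by
  intro xA yB hnot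
  clear hnot
  revert xA
  refine Finite.induction_of_potential (fun x => c x yB - α x) fun xA ih => ?_
  rcases hshield xA yB with h | ⟨xs, ys, hs, hN, hc⟩
  · refine ⟨2, fun _ => xA, fun _ => yB, le_rfl, rfl, rfl, fun i _ _ => by omega,
      fun _ _ _ => h, by simp⟩
  have h₁ := hfeas _ _ hN
  have h₂ := htight _ _ hs
  obtain ⟨n, x, y, hn, hx, hy, hsupp, hmem, hle⟩ := ih xs (by linarith)
  refine ⟨n + 1, fun i => if i ≤ 1 then xA else x (i - 1),
    fun i => if i ≤ 2 then ys else y (i - 1), by omega, by simp, ?_, ?_, ?_, ?_⟩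
  · simp [hy, show ¬ n + 1 ≤ 2 by omega]
  · intro i hi hin
    rcases hi.eq_or_lt with rfl | hi
    · simpa [hx] using hs
    · simpa [show ¬ i ≤ 1 by omega, show ¬ i ≤ 2 by omega] using
        hsupp (i - 1) (by omega) (by omega)
  · intro i hi hin
    rcases hi.eq_or_lt with rfl | hi
    · simpa using hN
    · have := hmem (i - 1) (by omega) (by omega)
      rw [Nat.sub_add_cancel (by omega)] at this
      simpa [show ¬ i ≤ 1 by omega, show ¬ i + 1 ≤ 2 by omega] using this
  · dsimp only
    rw [sum_Icc_links_succ c n hn (fun i => if i ≤ 1 then xA else x (i - 1))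
      (fun i => if i ≤ 2 then ys else y (i - 1))]
    have hsum : ∀ i ∈ Finset.Icc 2 (n - 1),
        (c (if i + 1 ≤ 1 then xA else x (i + 1 - 1)) (if i + 2 ≤ 2 then ys else y (i + 2 - 1)) -
          c (if i + 1 ≤ 1 then xA else x (i + 1 - 1)) (if i + 1 ≤ 2 then ys else y (i + 1 - 1))) =
        c (x i) (y (i + 1)) - c (x i) (y i) := by
      intro i hi
      have hi := (Finset.mem_Icc.mp hi).1
      simp [show i ≠ 0 by omega, show ¬ i + 1 ≤ 2 by omega]
    rw [Finset.sum_congr rfl hsum]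
    simp only [hx, hy] at hle
    simp only [Nat.reduceSub, Nat.reduceLeDiff, le_refl, if_true, if_false, hx, hy,
      Nat.add_sub_cancel, show ¬ n + 1 ≤ 2 by omega]
    linarith
end

section
/- Let X and Y be finite sets, c : X × Y → ℝ a cost function, π a coupling, and N ⊆ X × Y a shielding neighbourhood for π. If a dual pair (α, β) is locally feasible with respect to N and tight on π, then (α, β) is globally dual feasible, i.e. α(x) + β(y) ≤ c(x,y) for all (x,y) ∈ X × Y. -/
/-- **Global dual feasibility from local feasibility on a shielding neighbourhood.**
If `N` is a shielding neighbourhood for the coupling `π`, and the dual pair `(α, β)` is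
locally feasible w.r.t. `N` and tight on `π`, then `(α, β)` is globally dual feasible:
`α(x) + β(y) ≤ c(x, y)` for all `(x, y) ∈ X × Y`. -/
theorem shielding_implies_global_dual_feasibility
    {X Y : Type*} [Fintype X] [Fintype Y]
    (c : X → Y → ℝ) (N : Set (X × Y))
    (π : X → Y → ℝ)
    (hπ0 : ∀ x y, 0 ≤ π x y)
    (hπ1 : ∑ x, ∑ y, π x y = 1)
    (hsub : ∀ x y, 0 < π x y → (x, y) ∈ N)
    (hshield : ∀ xA yB, (xA, yB) ∈ N ∨
      ∃ xs ys, 0 < π xs ys ∧ (xA, ys) ∈ N ∧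
        c xA yB - c xs yB > c xA ys - c xs ys)
    (α : X → ℝ) (β : Y → ℝ)
    (hfeas : ∀ x y, (x, y) ∈ N → α x + β y ≤ c x y)
    (htight : ∀ x y, 0 < π x y → α x + β y = c x y) :
    ∀ x y, α x + β y ≤ c x y := by
  intro x y
  have : Nonempty X := ⟨x⟩
  obtain ⟨x₀, hmin⟩ := Finite.exists_min fun x => c x y - α x
  suffices α x₀ + β y ≤ c x₀ y by linarith [hmin x]
  rcases hshield x₀ y with hN | ⟨xs, ys, hpos, hN, hlt⟩
  · exact hfeas x₀ y hN
  · -- The shielding point would have strictly smaller slack than the minimizer.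
    linarith [hfeas x₀ ys hN, htight xs ys hpos, hmin xs]
end

section
/- Let X and Y be finite sets, μ and ν probability measures on X and Y, and c : X × Y → ℝ a cost function. Let π ∈ Π(μ,ν) be a coupling and N ⊆ X × Y a shielding neighbourhood for π. If π is a local optimizer with respect to N, i.e. C(π) ≤ C(π') for every π' ∈ Π(μ,ν) with spt π' ⊆ N, then π is a global optimizer: C(π) ≤ C(π') for every π' ∈ Π(μ,ν). -/
open Filter Topology in
/-- From a coupling `π` one can move a little way along any direction that is nonnegative
wherever `π` vanishes. -/
lemma exists_pos_forall_add_mul_nonneg {X Y : Type*} [Finite X] [Finite Y]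
    {π δ : X → Y → ℝ} (hπ : ∀ x y, 0 ≤ π x y) (hδ : ∀ x y, π x y = 0 → 0 ≤ δ x y) :
    ∃ ε : ℝ, 0 < ε ∧ ∀ x y, 0 ≤ π x y + ε * δ x y := by
  have h : ∀ᶠ ε : ℝ in 𝓝[>] 0, ∀ x y, 0 ≤ π x y + ε * δ x y := by
    refine eventually_all.2 fun x => eventually_all.2 fun y => ?_
    rcases (hπ x y).eq_or_lt with h0 | hpos
    · filter_upwards [self_mem_nhdsWithin] with ε hε
      rw [← h0, zero_add]
      exact mul_nonneg (le_of_lt hε) (hδ x y h0.symm)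
    · have hc : Tendsto (fun ε : ℝ => π x y + ε * δ x y) (𝓝 0) (𝓝 (π x y + 0 * δ x y)) :=
        Continuous.tendsto (by fun_prop) 0
      rw [zero_mul, add_zero] at hc
      filter_upwards [nhdsWithin_le_nhds (hc.eventually (lt_mem_nhds hpos))] with ε hε
      exact hε.le
  obtain ⟨ε, hε, hpos⟩ := (h.and self_mem_nhdsWithin).exists
  exact ⟨ε, hpos, hε⟩

/-- Finitely many lower bounds, each below each of finitely many upper bounds, leave room for
a real number in between. -/
lemma Set.Finite.exists_real_between {A B : Set ℝ} (hA : A.Finite) (hB : B.Finite)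
    (h : ∀ a ∈ A, ∀ b ∈ B, a ≤ b) : ∃ t, (∀ a ∈ A, a ≤ t) ∧ ∀ b ∈ B, t ≤ b := by
  rcases A.eq_empty_or_nonempty with rfl | hne
  · exact ⟨sInf B, by simp, fun b hb => csInf_le hB.bddBelow hb⟩
  · exact ⟨sSup A, fun a ha => le_csSup hA.bddAbove ha, fun b hb => csSup_le hne (h · · b hb)⟩

/-- A finite system of difference constraints `α b - α a ≤ w` is solvable when its constraints
belong to a transitively closed family whose closed constraints have nonnegative weight. -/
lemma exists_potential {X : Type*} {P : X → X → ℝ → Prop}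
    (htrans : ∀ a b d v w, P a b v → P b d w → P a d (v + w))
    (hloop : ∀ a w, P a a w → 0 ≤ w) (S : Finset X) (L : Set (X × X × ℝ)) (hL : L.Finite)
    (hLP : ∀ a b w, (a, b, w) ∈ L → P a b w)
    (hLS : ∀ a b w, (a, b, w) ∈ L → a ∈ S ∧ b ∈ S) :
    ∃ α : X → ℝ, ∀ a b w, (a, b, w) ∈ L → α b - α a ≤ w := by
  classical
  induction S using Finset.induction_on generalizing L with
  | empty => exact ⟨0, fun a b w h => absurd (hLS a b w h).1 (Finset.notMem_empty a)⟩
  | insert v S _ ih =>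
    set I : Set (X × X × ℝ) := {e ∈ L | e.1 ≠ v ∧ e.2.1 = v} with hI
    set O : Set (X × X × ℝ) := {e ∈ L | e.1 = v ∧ e.2.1 ≠ v} with hO
    have hIf : I.Finite := hL.subset fun e he => he.1
    have hOf : O.Finite := hL.subset fun e he => he.1
    obtain ⟨α, hα⟩ := ih
      ({e ∈ L | e.1 ≠ v ∧ e.2.1 ≠ v} ∪
        Set.image2 (fun e f => (e.1, f.2.1, e.2.2 + f.2.2)) I O)
      ((hL.subset fun e he => he.1).union (hIf.image2 _ hOf))
      (by
        rintro a b w (⟨h, -⟩ | ⟨⟨a', b', w'⟩, ⟨h, -, hb⟩, ⟨a'', b'', w''⟩, ⟨h', ha, -⟩, heq⟩)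
        · exact hLP _ _ _ h
        · simp only [Prod.mk.injEq] at heq hb ha
          obtain ⟨rfl, rfl, rfl⟩ := heq
          subst hb ha
          exact htrans _ _ _ _ _ (hLP _ _ _ h) (hLP _ _ _ h'))
      (by
        rintro a b w (⟨h, h1, h2⟩ | ⟨⟨a', b', w'⟩, ⟨h, hne, -⟩, ⟨a'', b'', w''⟩, ⟨h', -, hne'⟩, heq⟩)
        · have := hLS _ _ _ h
          simp only [Finset.mem_insert] at this
          exact ⟨this.1.resolve_left h1, this.2.resolve_left h2⟩
        · simp only [Prod.mk.injEq] at heq hne hne'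
          obtain ⟨rfl, rfl, rfl⟩ := heq
          exact ⟨(Finset.mem_insert.1 (hLS _ _ _ h).1).resolve_left hne,
            (Finset.mem_insert.1 (hLS _ _ _ h').2).resolve_left hne'⟩)
    obtain ⟨t, hOt, hIt⟩ := (hOf.image fun f => α f.2.1 - f.2.2).exists_real_between
      (hIf.image fun e => α e.1 + e.2.2) (by
        rintro _ ⟨f, hf, rfl⟩ _ ⟨e, he, rfl⟩
        have := hα _ _ _ (Or.inr (Set.mem_image2_of_mem he hf))
        dsimp only
        linarith)
    refine ⟨Function.update α v t, fun a b w h => ?_⟩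
    by_cases ha : a = v <;> by_cases hb : b = v
    · subst ha hb
      simpa using hloop _ _ (hLP _ _ _ h)
    · subst ha
      have := hOt _ ⟨_, ⟨h, rfl, hb⟩, rfl⟩
      simp only [Function.update_self, Function.update_of_ne hb]
      dsimp only at this
      linarith
    · subst hb
      have := hIt _ ⟨_, ⟨h, ha, rfl⟩, rfl⟩
      simp only [Function.update_self, Function.update_of_ne ha]
      dsimp only at this
      linarith
    · simp only [Function.update_of_ne ha, Function.update_of_ne hb]
      exact hα _ _ _ (Or.inl ⟨h, ha, hb⟩)

/-- `π` minimizes the cost among couplings supported in `N` only if there is a potential on `X`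
compatible with the cost along moves from the support of `π` into `N`. -/
lemma exists_potential_of_local_optimality {X Y : Type*} [Fintype X] [Fintype Y]
    (μ : X → ℝ) (ν : Y → ℝ) (c : X → Y → ℝ) (N : Set (X × Y)) (π : X → Y → ℝ)
    (hπ0 : ∀ x y, 0 ≤ π x y)
    (hπμ : ∀ x, ∑ y, π x y = μ x)
    (hπν : ∀ y, ∑ x, π x y = ν y)
    (hsub : ∀ x y, 0 < π x y → (x, y) ∈ N)
    (hlocal : ∀ π' : X → Y → ℝ, (∀ x y, 0 ≤ π' x y) → (∀ x, ∑ y, π' x y = μ x) →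
      (∀ y, ∑ x, π' x y = ν y) → (∀ x y, 0 < π' x y → (x, y) ∈ N) →
      ∑ x, ∑ y, c x y * π x y ≤ ∑ x, ∑ y, c x y * π' x y) :
    ∃ α : X → ℝ, ∀ x x' y, 0 < π x y → (x', y) ∈ N → α x' - α x ≤ c x' y - c x y := by
  classical
  let P : X → X → ℝ → Prop := fun a b w => ∃ δ : X → Y → ℝ,
    (∀ y, ∑ x, δ x y = 0) ∧
    (∀ x, ∑ y, δ x y = (if x = b then 1 else 0) - (if x = a then 1 else 0)) ∧
    (∀ x y, π x y = 0 → 0 ≤ δ x y) ∧ (∀ x y, (x, y) ∉ N → δ x y = 0) ∧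
    ∑ x, ∑ y, c x y * δ x y = w
  let L : Set (X × X × ℝ) := (fun p : X × X × Y => (p.1, p.2.1, c p.2.1 p.2.2 - c p.1 p.2.2)) ''
    {p | 0 < π p.1 p.2.2 ∧ (p.2.1, p.2.2) ∈ N}
  suffices h : (∀ a b d v w, P a b v → P b d w → P a d (v + w)) ∧ (∀ a w, P a a w → 0 ≤ w) ∧
      ∀ a b w, (a, b, w) ∈ L → P a b w by
    obtain ⟨α, hα⟩ := exists_potential h.1 h.2.1 Finset.univ L ((Set.toFinite _).image _) h.2.2
      (by simp)
    exact ⟨α, fun x x' y h h' => hα _ _ _ ⟨(x, x', y), ⟨h, h'⟩, rfl⟩⟩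
  refine ⟨?_, ?_, ?_⟩
  · rintro a b d v w ⟨δ, h1, h2, h3, h4, rfl⟩ ⟨η, k1, k2, k3, k4, rfl⟩
    refine ⟨fun x y => δ x y + η x y, fun y => ?_, fun x => ?_,
      fun x y h => add_nonneg (h3 x y h) (k3 x y h), fun x y h => ?_, ?_⟩
    · rw [Finset.sum_add_distrib, h1, k1, add_zero]
    · rw [Finset.sum_add_distrib, h2, k2]
      ring
    · simp [h4 x y h, k4 x y h]
    · simp only [mul_add, Finset.sum_add_distrib]
  · rintro a w ⟨δ, h1, h2, h3, h4, rfl⟩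
    obtain ⟨ε, hε, hnn⟩ := exists_pos_forall_add_mul_nonneg hπ0 h3
    have key := hlocal (fun x y => π x y + ε * δ x y) hnn
      (fun x => by rw [Finset.sum_add_distrib, ← Finset.mul_sum, h2, hπμ]; ring)
      (fun y => by rw [Finset.sum_add_distrib, ← Finset.mul_sum, h1, hπν]; ring)
      (fun x y h => by
        by_contra hN
        rw [h4 x y hN, mul_zero, add_zero] at h
        exact hN (hsub x y h))
    simp only [mul_add, Finset.sum_add_distrib, mul_left_comm _ ε, ← Finset.mul_sum] at key
    exact nonneg_of_mul_nonneg_right (by linarith) hε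
  · rintro a b w ⟨⟨x, x', y⟩, ⟨h, h'⟩, heq⟩
    simp only [Prod.mk.injEq] at heq h h'
    obtain ⟨rfl, rfl, rfl⟩ := heq
    refine ⟨fun z u => (if z = x' then if u = y then 1 else 0 else 0) -
      (if z = x then if u = y then 1 else 0 else 0), fun u => ?_, fun z => ?_,
      fun z u hz => ?_, fun z u hN => ?_, ?_⟩
    · simp
    · rw [Finset.sum_sub_distrib]
      split_ifs <;> simp
    · have : ¬ (z = x ∧ u = y) := by
        rintro ⟨rfl, rfl⟩
        exact h.ne' hz
      beta_reduce
      split_ifs <;> simp_all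
    · have hx' : ¬ (z = x' ∧ u = y) := by
        rintro ⟨rfl, rfl⟩
        exact hN h'
      have hx : ¬ (z = x ∧ u = y) := by
        rintro ⟨rfl, rfl⟩
        exact hN (hsub _ _ h)
      beta_reduce
      split_ifs <;> simp_all
    · simp [mul_sub, Finset.sum_sub_distrib, Finset.sum_ite_irrel]

/-- **Corollary (Global optimality from local optimality).**
Let `π ∈ Π(μ, ν)` be a coupling and `N` a shielding neighbourhood for `π`. If `π` is a
local optimizer w.r.t. `N` (it minimizes the total cost among couplings supported in `N`),
then `π` is a global optimizer of the transport problem. -/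
theorem local_optimality_implies_global_optimality
    {X Y : Type*} [Fintype X] [Fintype Y]
    (μ : X → ℝ) (ν : Y → ℝ)
    (hμ0 : ∀ x, 0 ≤ μ x) (hν0 : ∀ y, 0 ≤ ν y)
    (hμ1 : ∑ x, μ x = 1) (hν1 : ∑ y, ν y = 1)
    (c : X → Y → ℝ) (N : Set (X × Y))
    (π : X → Y → ℝ)
    (hπ0 : ∀ x y, 0 ≤ π x y)
    (hπμ : ∀ x, ∑ y, π x y = μ x)
    (hπν : ∀ y, ∑ x, π x y = ν y)
    (hsub : ∀ x y, 0 < π x y → (x, y) ∈ N)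
    (hshield : ∀ xA yB, (xA, yB) ∈ N ∨
      ∃ xs ys, 0 < π xs ys ∧ (xA, ys) ∈ N ∧
        c xA yB - c xs yB > c xA ys - c xs ys)
    (hlocal : ∀ π' : X → Y → ℝ, (∀ x y, 0 ≤ π' x y) → (∀ x, ∑ y, π' x y = μ x) →
      (∀ y, ∑ x, π' x y = ν y) → (∀ x y, 0 < π' x y → (x, y) ∈ N) →
      ∑ x, ∑ y, c x y * π x y ≤ ∑ x, ∑ y, c x y * π' x y) :
    ∀ π' : X → Y → ℝ, (∀ x y, 0 ≤ π' x y) → (∀ x, ∑ y, π' x y = μ x) →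
      (∀ y, ∑ x, π' x y = ν y) →
      ∑ x, ∑ y, c x y * π x y ≤ ∑ x, ∑ y, c x y * π' x y := by
  intro π' hπ0' hπμ' hπν'
  obtain ⟨α, hα⟩ :=
    exists_potential_of_local_optimality μ ν c N π hπ0 hπμ hπν hsub hlocal
  have : Nonempty X := by
    by_contra h
    rw [not_nonempty_iff] at h
    simp at hμ1
  choose m hm using fun y => Finite.exists_min fun x => c x y - α x
  have hmN : ∀ y, (m y, y) ∈ N := fun y => by
    refine (hshield (m y) y).resolve_right ?_
    rintro ⟨xs, ys, hpos, hN, hlt⟩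
    linarith [hα _ _ _ hpos hN, hm y xs]
  have hle : ∀ x y, α x + (c (m y) y - α (m y)) ≤ c x y := fun x y => by
    linarith [hm y x]
  have heq : ∀ x y, c x y * π x y = (α x + (c (m y) y - α (m y))) * π x y := fun x y => by
    rcases (hπ0 x y).eq_or_lt with h | h
    · rw [← h, mul_zero, mul_zero]
    · rw [le_antisymm (by linarith [hα _ _ _ h (hmN y)]) (hle x y)]
  have hdual : ∀ (β : Y → ℝ) (ρ : X → Y → ℝ), (∀ x, ∑ y, ρ x y = μ x) →
      (∀ y, ∑ x, ρ x y = ν y) →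
      ∑ x, ∑ y, (α x + β y) * ρ x y = ∑ x, α x * μ x + ∑ y, β y * ν y := by
    intro β ρ h1 h2
    simp only [add_mul, Finset.sum_add_distrib]
    rw [Finset.sum_comm (f := fun x y => β y * ρ x y)]
    simp only [← Finset.mul_sum, h1, h2]
  calc ∑ x, ∑ y, c x y * π x y
      = ∑ x, ∑ y, (α x + (c (m y) y - α (m y))) * π x y := by simp only [heq]
    _ = ∑ x, ∑ y, (α x + (c (m y) y - α (m y))) * π' x y := by
      rw [hdual (fun y => c (m y) y - α (m y)) π hπμ hπν,
        hdual (fun y => c (m y) y - α (m y)) π' hπμ' hπν']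
    _ ≤ ∑ x, ∑ y, c x y * π' x y :=
      Finset.sum_le_sum fun x _ => Finset.sum_le_sum fun y _ =>
        mul_le_mul_of_nonneg_right (hle x y) (hπ0' x y)
end

section
/- Let X and Y be finite sets, μ and ν probability measures on X and Y, and c : X × Y → ℝ a cost function. Let shield be a map assigning to each coupling π ∈ Π(μ,ν) a neighbourhood shield(π) ⊆ X × Y which is shielding for π (in particular spt π ⊆ shield(π)). Define a sequence of couplings by choosing any π₁ ∈ Π(μ,ν) and, for each k ≥ 1, choosing π_{k+1} as a minimizer of C over the nonempty set {π' ∈ Π(μ,ν) : spt π' ⊆ shield(π_k)}. Then the sequence (C(π_k)) is non-increasing, there exists k with C(π_{k+1}) = C(π_k), and for any such k the coupling π_k is a global optimizer, i.e. C(π_k) ≤ C(π') for all π' ∈ Π(μ,ν). -/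
/-- `π` is a coupling of the probability vectors `μ` and `ν`. -/
def IsCoupling {X Y : Type*} [Fintype X] [Fintype Y]
    (μ : X → ℝ) (ν : Y → ℝ) (π : X → Y → ℝ) : Prop :=
  (∀ x y, 0 ≤ π x y) ∧ (∀ x, ∑ y, π x y = μ x) ∧ (∀ y, ∑ x, π x y = ν y)

/-- Total transport cost `C(π) = Σ_{(x,y)} c(x,y) π(x,y)`. -/
def TotalCost {X Y : Type*} [Fintype X] [Fintype Y]
    (c : X → Y → ℝ) (π : X → Y → ℝ) : ℝ :=
  ∑ x, ∑ y, c x y * π x y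

/-- `N` is a shielding neighbourhood for `π` w.r.t. the cost `c`:
`spt π ⊆ N` and every pair `(x_A, y_B)` is either in `N` or shielded from some
`(x_s, y_s) ∈ spt π` with `(x_A, y_s) ∈ N`. -/
def IsShielding {X Y : Type*} [Fintype X] [Fintype Y]
    (c : X → Y → ℝ) (π : X → Y → ℝ) (N : Set (X × Y)) : Prop :=
  (∀ x y, 0 < π x y → (x, y) ∈ N) ∧
  ∀ xA yB, (xA, yB) ∈ N ∨
    ∃ xs ys, 0 < π xs ys ∧ (xA, ys) ∈ N ∧
      c xA yB - c xs yB > c xA ys - c xs ys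

open Filter Topology

section Couplings

variable {X Y : Type*} [Fintype X] [Fintype Y] {μ : X → ℝ} {ν : Y → ℝ}

theorem totalCost_linearCombination (c : X → Y → ℝ) (a b : ℝ) (p q : X → Y → ℝ) :
    TotalCost c (a • p + b • q) = a * TotalCost c p + b * TotalCost c q := by
  simp only [TotalCost, Finset.mul_sum, ← Finset.sum_add_distrib]
  refine Finset.sum_congr rfl fun x _ => Finset.sum_congr rfl fun y _ => ?_
  simp only [Pi.add_apply, Pi.smul_apply, smul_eq_mul]
  ring

theorem totalCost_penalized (c d : X → Y → ℝ) (M : ℝ) (p : X → Y → ℝ) :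
    TotalCost (c + M • d) p = TotalCost c p + M * TotalCost d p := by
  simp only [TotalCost, Finset.mul_sum, ← Finset.sum_add_distrib]
  refine Finset.sum_congr rfl fun x _ => Finset.sum_congr rfl fun y _ => ?_
  simp only [Pi.add_apply, Pi.smul_apply, smul_eq_mul]
  ring

theorem continuous_totalCost (c : X → Y → ℝ) : Continuous (TotalCost c) := by
  unfold TotalCost
  fun_prop

theorem IsCoupling.affineCombination {p q : X → Y → ℝ} (hp : IsCoupling μ ν p)
    (hq : IsCoupling μ ν q) {a b : ℝ} (hab : a + b = 1)
    (h : ∀ x y, 0 ≤ a * p x y + b * q x y) : IsCoupling μ ν (a • p + b • q) := by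
  refine ⟨h, fun x => ?_, fun y => ?_⟩
  · simp only [Pi.add_apply, Pi.smul_apply, smul_eq_mul, Finset.sum_add_distrib,
      ← Finset.mul_sum, hp.2.1, hq.2.1, ← add_mul, hab, one_mul]
  · simp only [Pi.add_apply, Pi.smul_apply, smul_eq_mul, Finset.sum_add_distrib,
      ← Finset.mul_sum, hp.2.2, hq.2.2, ← add_mul, hab, one_mul]

theorem isCompact_couplings (μ : X → ℝ) (ν : Y → ℝ) : IsCompact {p | IsCoupling μ ν p} := by
  refine (isCompact_Icc (a := (0 : X → Y → ℝ)) (b := fun x _ => μ x)).of_isClosed_subset ?_ ?_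
  · simp only [IsCoupling, Set.ofPred_and, Set.ofPred_forall]
    refine IsClosed.inter ?_ (IsClosed.inter ?_ ?_)
    · exact isClosed_iInter fun x => isClosed_iInter fun y =>
        isClosed_le continuous_const (by fun_prop)
    · exact isClosed_iInter fun x => isClosed_eq (by fun_prop) continuous_const
    · exact isClosed_iInter fun y => isClosed_eq (by fun_prop) continuous_const
  · intro p hp
    refine ⟨hp.1, fun x y => ?_⟩
    refine le_of_le_of_eq ?_ (hp.2.1 x)
    exact Finset.single_le_sum (f := fun y => p x y) (fun y _ => hp.1 x y) (Finset.mem_univ y)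

/-- An extreme coupling is the only coupling carried by its support. -/
theorem eq_of_mem_extremePoints_couplings {p q : X → Y → ℝ}
    (hp : p ∈ Set.extremePoints ℝ {p | IsCoupling μ ν p}) (hq : IsCoupling μ ν q)
    (hqp : ∀ x y, 0 < q x y → 0 < p x y) : q = p := by
  have hpc : IsCoupling μ ν p := hp.1
  have key : ∀ᶠ t : ℝ in 𝓝[>] 0, ∀ x y, t * q x y ≤ p x y := by
    refine eventually_all.2 fun x => eventually_all.2 fun y => ?_
    rcases (hq.1 x y).eq_or_lt with h | h
    · exact Eventually.of_forall fun t => by rw [← h, mul_zero]; exact hpc.1 x y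
    · have hc : Tendsto (fun t : ℝ => t * q x y) (𝓝 0) (𝓝 (0 * q x y)) :=
        (continuous_id.mul continuous_const).tendsto 0
      rw [zero_mul] at hc
      exact ((hc.eventually_lt_const (hqp x y h)).filter_mono nhdsWithin_le_nhds).mono
        fun _ => le_of_lt
  obtain ⟨t, ht, ht0, ht1⟩ := (key.and (Ioo_mem_nhdsGT (zero_lt_one (α := ℝ)))).exists
  have hs : 0 < 1 - t := sub_pos.2 ht1
  have hr : IsCoupling μ ν ((1 - t)⁻¹ • p + (-(t * (1 - t)⁻¹)) • q) := by
    refine hpc.affineCombination hq (by field_simp; ring) fun x y => ?_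
    have := mul_nonneg (inv_pos.2 hs).le (sub_nonneg.2 (ht x y))
    linarith
  refine hp.2 hq hr ⟨t, 1 - t, ht0, hs, by ring, ?_⟩
  ext x y
  simp only [Pi.add_apply, Pi.smul_apply, smul_eq_mul]
  field_simp
  ring

theorem finite_extremePoints_couplings (μ : X → ℝ) (ν : Y → ℝ) :
    (Set.extremePoints ℝ {p | IsCoupling μ ν p}).Finite := by
  refine Set.Finite.of_finite_image (f := fun p => {z : X × Y | 0 < p z.1 z.2})
    (Set.toFinite _) fun p hp q hq hpq => ?_
  refine eq_of_mem_extremePoints_couplings hq hp.1 fun x y h => ?_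
  exact (Set.ext_iff.1 hpq (x, y)).1 h

/-- A lower bound for the cost of extreme couplings is valid for all couplings. -/
theorem le_totalCost_of_extremePoints {c : X → Y → ℝ} {a : ℝ}
    (h : ∀ p ∈ Set.extremePoints ℝ {p | IsCoupling μ ν p}, a ≤ TotalCost c p)
    {p : X → Y → ℝ} (hp : IsCoupling μ ν p) : a ≤ TotalCost c p := by
  have hconv : Convex ℝ {p | IsCoupling μ ν p} := fun p hp q hq s t hs ht hst =>
    IsCoupling.affineCombination hp hq hst fun x y =>
      add_nonneg (mul_nonneg hs (hp.1 x y)) (mul_nonneg ht (hq.1 x y))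
  have hp' : p ∈ closure (convexHull ℝ (Set.extremePoints ℝ {p | IsCoupling μ ν p})) := by
    rw [closure_convexHull_extremePoints (isCompact_couplings μ ν) hconv]
    exact hp
  have hhalf : Convex ℝ {q | a ≤ TotalCost c q} := by
    intro q hq r hr s t hs ht hst
    simp only [Set.mem_ofPred_eq] at hq hr ⊢
    rw [totalCost_linearCombination]
    calc a = s * a + t * a := by rw [← add_mul, hst, one_mul]
      _ ≤ _ := by gcongr
  exact closure_minimal (convexHull_min h hhalf)
    (isClosed_le continuous_const (continuous_totalCost c)) hp'

/-- If `p` charges `(x₁, y₁)` and `(x₂, y₂)`, and exchanging the partners is cheaper, then some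
coupling is cheaper than `p`. -/
theorem exists_totalCost_lt_of_exchange {c p : X → Y → ℝ} (hp : IsCoupling μ ν p)
    {x₁ x₂ : X} {y₁ y₂ : Y} (h₁ : 0 < p x₁ y₁) (h₂ : 0 < p x₂ y₂)
    (hx : x₁ ≠ x₂) (hy : y₁ ≠ y₂) (hc : c x₁ y₂ + c x₂ y₁ < c x₁ y₁ + c x₂ y₂) :
    ∃ q, IsCoupling μ ν q ∧ TotalCost c q < TotalCost c p := by
  classical
  obtain ⟨ε, hε, hε₁, hε₂⟩ : ∃ ε, 0 < ε ∧ ε ≤ p x₁ y₁ ∧ ε ≤ p x₂ y₂ :=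
    ⟨min (p x₁ y₁) (p x₂ y₂), lt_min h₁ h₂, min_le_left _ _, min_le_right _ _⟩
  let a : X → ℝ := Pi.single x₁ 1 - Pi.single x₂ 1
  let b : Y → ℝ := Pi.single y₁ 1 - Pi.single y₂ 1
  let d : X → Y → ℝ := fun x y => a x * b y
  have ha : ∑ x, a x = 0 := by simp [a]
  have hb : ∑ y, b y = 0 := by simp [b]
  have hd : TotalCost c d = c x₁ y₁ + c x₂ y₂ - (c x₁ y₂ + c x₂ y₁) := by
    have hcb : ∀ x, ∑ y, c x y * d x y = a x * (c x y₁ - c x y₂) := fun x => by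
      simp only [d, mul_left_comm (c x _), ← Finset.mul_sum]
      simp [b, mul_sub, Finset.sum_sub_distrib, Pi.single_apply]
    simp only [TotalCost, hcb]
    simp only [a, Pi.sub_apply, sub_mul, Finset.sum_sub_distrib, Pi.single_apply, ite_mul,
      one_mul, zero_mul, Finset.sum_ite_eq', Finset.mem_univ, if_true]
    ring
  refine ⟨(1 : ℝ) • p + (-ε) • d, ⟨fun x y => ?_, fun x => ?_, fun y => ?_⟩, ?_⟩
  · have h0 := hp.1 x y
    simp only [Pi.add_apply, Pi.smul_apply, smul_eq_mul, d, a, b, Pi.sub_apply, Pi.single_apply]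
    by_cases hx₁ : x = x₁ <;> by_cases hx₂ : x = x₂ <;>
      by_cases hy₁ : y = y₁ <;> by_cases hy₂ : y = y₂ <;> simp_all <;> linarith
  · simp only [Pi.add_apply, Pi.smul_apply, smul_eq_mul, Finset.sum_add_distrib,
      ← Finset.mul_sum, d, hb, hp.2.1]
    ring
  · simp only [Pi.add_apply, Pi.smul_apply, smul_eq_mul, Finset.sum_add_distrib,
      ← Finset.mul_sum, d, ← Finset.sum_mul, ha, hp.2.2]
    ring
  · rw [totalCost_linearCombination, hd]
    nlinarith

/-- A coupling that is optimal among the couplings supported in one of its shielding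
neighbourhoods is globally optimal. -/
theorem IsShielding.totalCost_le {c p : X → Y → ℝ} {N : Set (X × Y)} (hN : IsShielding c p N)
    (hp : IsCoupling μ ν p)
    (hopt : ∀ q, IsCoupling μ ν q → (∀ x y, 0 < q x y → (x, y) ∈ N) →
      TotalCost c p ≤ TotalCost c q)
    {q : X → Y → ℝ} (hq : IsCoupling μ ν q) : TotalCost c p ≤ TotalCost c q := by
  classical
  let I : X → Y → ℝ := fun x y => if (x, y) ∈ N then 0 else 1
  have hI0 : ∀ x y, 0 ≤ I x y := fun x y => by dsimp only [I]; split_ifs <;> norm_num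
  have hI1 : ∀ x y, I x y ≤ 1 := fun x y => by dsimp only [I]; split_ifs <;> norm_num
  have hmass0 : ∀ v, IsCoupling μ ν v → 0 ≤ TotalCost I v := fun v hv =>
    Finset.sum_nonneg fun x _ => Finset.sum_nonneg fun y _ => mul_nonneg (hI0 x y) (hv.1 x y)
  have hsupp : ∀ v, IsCoupling μ ν v → (∀ x y, 0 < v x y → (x, y) ∈ N) →
      TotalCost I v = 0 := fun v hv h =>
    Finset.sum_eq_zero fun x _ => Finset.sum_eq_zero fun y _ => by
      rcases (hv.1 x y).eq_or_lt with h0 | h0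
      · rw [← h0, mul_zero]
      · simp [I, h x y h0]
  by_contra! hlt
  let E := Set.extremePoints ℝ {v | IsCoupling μ ν v}
  obtain ⟨w, hwE, hw⟩ : ∃ w ∈ E, TotalCost c w < TotalCost c p := by
    by_contra! h
    exact hlt.not_ge (le_totalCost_of_extremePoints h hq)
  have hpos : ∀ v, IsCoupling μ ν v → TotalCost c v < TotalCost c p → 0 < TotalCost I v := by
    intro v hv hvp
    refine (hmass0 v hv).lt_of_ne fun h => hvp.not_ge (hopt v hv fun x y hxy => ?_)
    by_contra hn
    have h1 := (Finset.sum_eq_zero_iff_of_nonneg fun x _ =>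
      Finset.sum_nonneg fun y _ => mul_nonneg (hI0 x y) (hv.1 x y)).1 h.symm x (Finset.mem_univ x)
    have h2 := (Finset.sum_eq_zero_iff_of_nonneg fun y _ =>
      mul_nonneg (hI0 x y) (hv.1 x y)).1 h1 y (Finset.mem_univ y)
    simp [I, hn, hxy.ne'] at h2
  let F := {v ∈ E | TotalCost c v < TotalCost c p}
  have hF : F.Finite := (finite_extremePoints_couplings μ ν).subset fun v hv => hv.1
  obtain ⟨v, ⟨hvE, hv⟩, hmax⟩ := Set.exists_max_image F
    (fun v => (TotalCost c p - TotalCost c v) / TotalCost I v) hF ⟨w, hwE, hw⟩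
  have hvc : IsCoupling μ ν v := hvE.1
  have hvI := hpos v hvc hv
  set M := (TotalCost c p - TotalCost c v) / TotalCost I v with hM
  have hM0 : 0 < M := div_pos (sub_pos.2 hv) hvI
  have hpen : ∀ r, IsCoupling μ ν r → TotalCost c p ≤ TotalCost (c + M • I) r := fun r hr => by
    refine le_totalCost_of_extremePoints (fun u hu => ?_) hr
    rw [totalCost_penalized]
    rcases lt_or_ge (TotalCost c u) (TotalCost c p) with h | h
    · have := (div_le_iff₀ (hpos u hu.1 h)).1 (hmax u ⟨hu, h⟩)
      linarith
    · have := mul_nonneg hM0.le (hmass0 u hu.1)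
      linarith
  have hvpen : TotalCost (c + M • I) v = TotalCost c p := by
    rw [totalCost_penalized, hM, div_mul_cancel₀ _ hvI.ne']
    ring
  have hppen : TotalCost (c + M • I) p = TotalCost c p := by
    rw [totalCost_penalized, hsupp p hp hN.1, mul_zero, add_zero]
  obtain ⟨xA, yB, hAB, hABN⟩ : ∃ x y, 0 < v x y ∧ (x, y) ∉ N := by
    by_contra! h
    exact hvI.ne' (hsupp v hvc h)
  obtain ⟨xs, ys, hs, hAs, hsh⟩ := (hN.2 xA yB).resolve_left hABN
  have hmid : IsCoupling μ ν ((1 / 2 : ℝ) • p + (1 / 2 : ℝ) • v) :=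
    hp.affineCombination hvc (by norm_num) fun x y => by
      have := hp.1 x y
      have := hvc.1 x y
      positivity
  obtain ⟨r, hr, hrlt⟩ := exists_totalCost_lt_of_exchange (c := c + M • I) hmid
    (x₁ := xA) (x₂ := xs) (y₁ := yB) (y₂ := ys)
    (by
      have := hp.1 xA yB
      simp only [Pi.add_apply, Pi.smul_apply, smul_eq_mul]
      positivity)
    (by
      have := hvc.1 xs ys
      simp only [Pi.add_apply, Pi.smul_apply, smul_eq_mul]
      positivity)
    (by rintro rfl; simp at hsh) (by rintro rfl; simp at hsh)
    (by
      have h1 : I xA yB = 1 := if_neg hABN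
      have h2 : I xA ys = 0 := if_pos hAs
      have h3 : I xs ys = 0 := if_pos (hN.1 xs ys hs)
      have h4 := mul_le_mul_of_nonneg_left (hI1 xs yB) hM0.le
      simp only [Pi.add_apply, Pi.smul_apply, smul_eq_mul, h1, h2, h3]
      linarith)
  rw [totalCost_linearCombination, hvpen, hppen] at hrlt
  have := hpen r hr
  linarith

end Couplings

/-- **Convergence of the sparse algorithm (Algorithm `solveSparse`).**
Let `shield` assign to every coupling a shielding neighbourhood, and let `(π_k)_{k ≥ 1}`
be a sequence of couplings where `π_{k+1}` minimizes the total cost among couplings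
supported in `shield(π_k)`. Then `(C(π_k))` is non-increasing, there is some `k` with
`C(π_{k+1}) = C(π_k)`, and for any such `k` the coupling `π_k` is a global optimizer. -/
theorem sparse_algorithm_terminates_globally_optimal
    {X Y : Type*} [Fintype X] [Fintype Y]
    (μ : X → ℝ) (ν : Y → ℝ)
    (hμ0 : ∀ x, 0 ≤ μ x) (hν0 : ∀ y, 0 ≤ ν y)
    (hμ1 : ∑ x, μ x = 1) (hν1 : ∑ y, ν y = 1)
    (c : X → Y → ℝ)
    (shield : (X → Y → ℝ) → Set (X × Y))
    (hshield : ∀ π, IsCoupling μ ν π → IsShielding c π (shield π))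
    (π : ℕ → X → Y → ℝ)
    (hcoup : ∀ k, 1 ≤ k → IsCoupling μ ν (π k))
    (hsupp : ∀ k, 1 ≤ k → ∀ x y, 0 < π (k + 1) x y → (x, y) ∈ shield (π k))
    (hmin : ∀ k, 1 ≤ k → ∀ π', IsCoupling μ ν π' →
      (∀ x y, 0 < π' x y → (x, y) ∈ shield (π k)) →
      TotalCost c (π (k + 1)) ≤ TotalCost c π') :
    (∀ k, 1 ≤ k → TotalCost c (π (k + 1)) ≤ TotalCost c (π k)) ∧
    (∃ k, 1 ≤ k ∧ TotalCost c (π (k + 1)) = TotalCost c (π k)) ∧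
    (∀ k, 1 ≤ k → TotalCost c (π (k + 1)) = TotalCost c (π k) →
      ∀ π', IsCoupling μ ν π' → TotalCost c (π k) ≤ TotalCost c π') := by
  have hmono : ∀ k, 1 ≤ k → TotalCost c (π (k + 1)) ≤ TotalCost c (π k) := fun k hk =>
    hmin k hk _ (hcoup k hk) (hshield _ (hcoup k hk)).1
  refine ⟨hmono, ?_, fun k hk heq π' hπ' => ?_⟩
  · by_contra! hne
    have hanti : StrictAnti fun k => TotalCost c (π (k + 2)) := strictAnti_nat_of_succ_lt fun k =>
      (hmono (k + 2) (by omega)).lt_of_ne (hne (k + 2) (by omega))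
    obtain ⟨i, j, hij, hs⟩ :=
      Finite.exists_ne_map_eq_of_infinite fun k : ℕ => shield (π (k + 1))
    have hle : ∀ a b, shield (π (a + 1)) = shield (π (b + 1)) →
        TotalCost c (π (a + 2)) ≤ TotalCost c (π (b + 2)) := fun a b hab =>
      hmin (a + 1) (by omega) _ (hcoup (b + 2) (by omega)) fun x y hxy => by
        rw [hab]
        exact hsupp (b + 1) (by omega) x y hxy
    exact hij (hanti.injective (le_antisymm (hle i j hs) (hle j i hs.symm)))
  · refine (hshield _ (hcoup k hk)).totalCost_le (hcoup k hk) (fun q hq hqN => ?_) hπ'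
    rw [← heq]
    exact hmin k hk q hq hqN
end

section
/- Let E be a real inner product space, p ∈ (1,∞), and x_A, x_s, r ∈ E with x_A ≠ x_s, and let ρ ≥ 0. Define θ = arcsin(ρ/‖x_s − r‖) if ρ < ‖x_s − r‖ and θ = π otherwise; φ = min{π, ∠(x_A − x_s, x_s − r) + θ}, where ∠(a,b) denotes the angle between the vectors a and b; and R = max{0, ‖x_s − r‖ − ρ} if cos φ ≥ 0, while R = ‖x_s − r‖ + ρ if cos φ < 0. Then for every y ∈ E with ‖y − r‖ ≤ ρ one has ‖x_A − y‖^p − ‖x_s − y‖^p ≥ p·R^{p−1}·‖x_A − x_s‖·cos φ. -/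
open scoped RealInnerProductSpace

open InnerProductGeometry in
/-- A vector `v` within distance `ρ < ‖w‖` of `w` makes an angle of at most
`arcsin (ρ / ‖w‖)` with `w`. -/
theorem angle_le_arcsin_of_norm_sub_le
    {E : Type*} [NormedAddCommGroup E] [InnerProductSpace ℝ E]
    {v w : E} {ρ : ℝ} (hρ : ρ < ‖w‖) (h : ‖w - v‖ ≤ ρ) :
    angle w v ≤ Real.arcsin (ρ / ‖w‖) := by
  have hρ0 : 0 ≤ ρ := (norm_nonneg _).trans h
  have hw : 0 < ‖w‖ := hρ0.trans_lt hρ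
  have hv : 0 < ‖v‖ := by
    have := norm_sub_norm_le w v
    linarith
  set t := Real.arcsin (ρ / ‖w‖)
  have hsin : Real.sin t * ‖w‖ = ρ := by
    rw [Real.sin_arcsin (by linarith [div_nonneg hρ0 hw.le]) ((div_le_one hw).2 hρ.le),
      div_mul_cancel₀ _ hw.ne']
  have hcos : Real.cos t * (‖w‖ * ‖v‖) ≤ ⟪w, v⟫ := by
    have hsq : ‖w - v‖ ^ 2 ≤ ρ ^ 2 := by gcongr
    rw [norm_sub_sq_real, ← hsin] at hsq
    have := Real.sin_sq_add_cos_sq t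
    nlinarith [sq_nonneg (‖w‖ * Real.cos t - ‖v‖)]
  refine (Real.strictAntiOn_cos.le_iff_ge ⟨Real.arcsin_nonneg.2 (by positivity), ?_⟩
    ⟨angle_nonneg _ _, angle_le_pi _ _⟩).1 ?_
  · linarith [Real.arcsin_le_pi_div_two (ρ / ‖w‖), Real.pi_pos]
  · rwa [cos_angle, le_div_iff₀ (by positivity)]

/-- The tangent line inequality for `s ↦ s ^ p` at `b > 0`. -/
theorem mul_rpow_sub_one_mul_sub_le_rpow_sub_rpow {p a b : ℝ} (hp : 1 ≤ p) (ha : 0 ≤ a)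
    (hb : 0 < b) : p * b ^ (p - 1) * (a - b) ≤ a ^ p - b ^ p := by
  have h := one_add_mul_self_le_rpow_one_add (s := a / b - 1)
    (by linarith [div_nonneg ha hb.le]) hp
  rw [add_sub_cancel, Real.div_rpow ha hb.le, le_div_iff₀ (by positivity)] at h
  have hbp : b ^ p = b ^ (p - 1) * b := by
    rw [← Real.rpow_add_one hb.ne', sub_add_cancel]
  have e : (1 + p * (a / b - 1)) * b ^ p = b ^ p + p * b ^ (p - 1) * (a - b) := by
    rw [hbp]
    field_simp
  linarith

open InnerProductGeometry in
/-- The gradient inequality for the convex function `‖·‖ ^ p`. -/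
theorem mul_cos_angle_le_norm_add_rpow_sub_norm_rpow
    {E : Type*} [NormedAddCommGroup E] [InnerProductSpace ℝ E]
    {p : ℝ} (hp : 1 < p) (u v : E) :
    p * ‖v‖ ^ (p - 1) * ‖u‖ * Real.cos (angle u v) ≤ ‖u + v‖ ^ p - ‖v‖ ^ p := by
  rcases eq_or_ne v 0 with rfl | hv
  · have h1 : p - 1 ≠ 0 := by linarith
    have h2 : p ≠ 0 := by linarith
    simp only [norm_zero, Real.zero_rpow h1, Real.zero_rpow h2, add_zero, mul_zero, zero_mul,
      sub_zero]
    positivity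
  · have hv' : 0 < ‖v‖ := norm_pos_iff.2 hv
    refine le_trans ?_
      (mul_rpow_sub_one_mul_sub_le_rpow_sub_rpow hp.le (norm_nonneg (u + v)) hv')
    rw [mul_assoc _ ‖u‖]
    refine mul_le_mul_of_nonneg_left ?_ (by positivity)
    have h := real_inner_le_norm (u + v) v
    rw [inner_add_left, real_inner_self_eq_norm_sq, ← cos_angle_mul_norm_mul_norm] at h
    refine le_of_mul_le_mul_right ?_ hv'
    linarith

open scoped RealInnerProductSpace

/-- **Proposition (Hierarchical lower bound for `c(x,y) = ‖x − y‖^p`).**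
With `θ`, `φ` and `R` defined from `x_A`, `x_s`, the representative `r` and radius `ρ`
as in the statement, for every `y` in the closed ball of radius `ρ` around `r` one has
`‖x_A − y‖^p − ‖x_s − y‖^p ≥ p · R^{p−1} · ‖x_A − x_s‖ · cos φ`. -/
theorem pth_power_hierarchical_lower_bound
    {E : Type*} [NormedAddCommGroup E] [InnerProductSpace ℝ E]
    (p : ℝ) (hp : 1 < p)
    (xA xs r : E) (hne : xA ≠ xs) (ρ : ℝ) (hρ : 0 ≤ ρ)
    (θ φ R : ℝ)
    (hθ : θ = if ρ < ‖xs - r‖ then Real.arcsin (ρ / ‖xs - r‖) else Real.pi)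
    (hφ : φ = min Real.pi (InnerProductGeometry.angle (xA - xs) (xs - r) + θ))
    (hR : R = if 0 ≤ Real.cos φ then max 0 (‖xs - r‖ - ρ) else ‖xs - r‖ + ρ)
    (y : E) (hy : ‖y - r‖ ≤ ρ) :
    ‖xA - y‖ ^ p - ‖xs - y‖ ^ p ≥ p * R ^ (p - 1) * ‖xA - xs‖ * Real.cos φ := by
  have hv := mul_cos_angle_le_norm_add_rpow_sub_norm_rpow hp (xA - xs) (xs - y)
  rw [sub_add_sub_cancel] at hv
  refine ge_iff_le.2 (le_trans ?_ hv)
  have hsub : ‖(xs - r) - (xs - y)‖ ≤ ρ := by rwa [sub_sub_sub_cancel_left]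
  have hangle : InnerProductGeometry.angle (xA - xs) (xs - y) ≤ φ := by
    rw [hφ]
    refine le_min (InnerProductGeometry.angle_le_pi _ _) ?_
    rw [hθ]
    split_ifs with h
    · grw [InnerProductGeometry.angle_le_angle_add_angle _ (xs - r) _,
        angle_le_arcsin_of_norm_sub_le h hsub]
    · linarith [InnerProductGeometry.angle_le_pi (xA - xs) (xs - y),
        InnerProductGeometry.angle_nonneg (xA - xs) (xs - r)]
  have hcos : Real.cos φ ≤ Real.cos (InnerProductGeometry.angle (xA - xs) (xs - y)) :=
    Real.cos_le_cos_of_nonneg_of_le_pi (InnerProductGeometry.angle_nonneg _ _)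
      (hφ ▸ min_le_left _ _) hangle
  have hpow : ‖xs - y‖ ^ (p - 1) * Real.cos φ ≥ R ^ (p - 1) * Real.cos φ := by
    have hp' : 0 ≤ p - 1 := by linarith
    rw [hR]
    split_ifs with h
    · have hle : max 0 (‖xs - r‖ - ρ) ≤ ‖xs - y‖ :=
        max_le (norm_nonneg _) (by linarith [norm_sub_norm_le (xs - r) (xs - y)])
      gcongr
    · have hle : ‖xs - y‖ ≤ ‖xs - r‖ + ρ := by
        rw [norm_sub_rev] at hsub
        linarith [norm_sub_norm_le (xs - y) (xs - r)]
      exact mul_le_mul_of_nonpos_right (by gcongr) (not_le.1 h).le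
  calc p * R ^ (p - 1) * ‖xA - xs‖ * Real.cos φ
      = p * ‖xA - xs‖ * (R ^ (p - 1) * Real.cos φ) := by ring
    _ ≤ p * ‖xA - xs‖ * (‖xs - y‖ ^ (p - 1) * Real.cos φ) := by gcongr
    _ = p * ‖xs - y‖ ^ (p - 1) * ‖xA - xs‖ * Real.cos φ := by ring
    _ ≤ _ := by gcongr
end

section
/- Let E be a real inner product space and u, δ ∈ E with ‖δ‖ < ‖u‖. Then the angle between u and u − δ satisfies ∠(u, u − δ) ≤ arcsin(‖δ‖/‖u‖). -/
/-- **Angle perturbation bound.** If `‖δ‖ < ‖u‖` then the (unsigned) angle between `u`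
and `u − δ` is at most `arcsin(‖δ‖ / ‖u‖)`. -/
theorem angle_sub_le_arcsin
    {E : Type*} [NormedAddCommGroup E] [InnerProductSpace ℝ E]
    (u δ : E) (h : ‖δ‖ < ‖u‖) :
    InnerProductGeometry.angle u (u - δ) ≤ Real.arcsin (‖δ‖ / ‖u‖) := by
  have hu : 0 < ‖u‖ := (norm_nonneg δ).trans_lt h
  have hw : 0 < ‖u - δ‖ := (sub_pos.2 h).trans_le (norm_sub_norm_le u δ)
  have hc : inner ℝ u δ ≤ ‖u‖ * ‖δ‖ := real_inner_le_norm u δ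
  have hp : inner ℝ u (u - δ) = ‖u‖ ^ 2 - inner ℝ u δ := by
    rw [inner_sub_right, real_inner_self_eq_norm_sq]
  have hp0 : 0 ≤ ‖u‖ ^ 2 - inner ℝ u δ := by nlinarith
  rw [Real.arcsin_eq_arccos (by positivity), InnerProductGeometry.angle, hp]
  apply Real.arccos_le_arccos
  apply Real.sqrt_le_iff.2 ⟨by positivity, ?_⟩
  have key : (‖u‖ ^ 2 - ‖δ‖ ^ 2) * ‖u - δ‖ ^ 2 ≤ (‖u‖ ^ 2 - inner ℝ u δ) ^ 2 := by
    rw [norm_sub_sq_real]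
    nlinarith [sq_nonneg (inner ℝ u δ - ‖δ‖ ^ 2)]
  rw [div_pow (_ - _), le_div_iff₀ (by positivity)]
  calc (1 - (‖δ‖ / ‖u‖) ^ 2) * (‖u‖ * ‖u - δ‖) ^ 2
      = (‖u‖ ^ 2 - ‖δ‖ ^ 2) * ‖u - δ‖ ^ 2 := by field_simp
    _ ≤ _ := key
end

section
/- Let E be a real inner product space, h : E → ℝ a strictly convex function, and define the cost c(x,y) = h(x − y). Let x_A, x_s, y_s, y_B ∈ E with x_A ≠ x_s, let ξ₁ be a subgradient of h at x_s − y_B and ξ₂ a subgradient of h at x_A − y_s. If ⟨ξ₁ − ξ₂, x_A − x_s⟩ ≥ 0, then (x_s,y_s) shields x_A from y_B, i.e. c(x_A,y_B) − c(x_s,y_B) > c(x_A,y_s) − c(x_s,y_s). -/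
open scoped RealInnerProductSpace

/-- The subgradient inequality of a strictly convex function is strict away from the base point. -/
theorem subgradient_lt_of_strictly_convex
    {E : Type*} [NormedAddCommGroup E] [InnerProductSpace ℝ E] {h : E → ℝ}
    (hconv : ∀ z₁ z₂ : E, z₁ ≠ z₂ → ∀ t : ℝ, t ∈ Set.Ioo (0 : ℝ) 1 →
      h (t • z₁ + (1 - t) • z₂) < t * h z₁ + (1 - t) * h z₂)
    {z₀ z ξ : E} (hξ : ∀ w, h w ≥ h z₀ + ⟪ξ, w - z₀⟫) (hne : z ≠ z₀) :
    h z₀ + ⟪ξ, z - z₀⟫ < h z := by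
  have hmid := hconv z z₀ hne (1 / 2) ⟨by norm_num, by norm_num⟩
  have hsub := hξ ((1 / 2 : ℝ) • z + (1 - 1 / 2 : ℝ) • z₀)
  have hdiff : (1 / 2 : ℝ) • z + (1 - 1 / 2 : ℝ) • z₀ - z₀ = (1 / 2 : ℝ) • (z - z₀) := by
    module
  rw [hdiff, real_inner_smul_right] at hsub
  linarith

/-- **Sufficient shielding condition for strictly convex costs.**
For the cost `c(x, y) = h(x − y)` with `h` strictly convex, if `ξ₁` is a subgradient of
`h` at `x_s − y_B`, `ξ₂` is a subgradient of `h` at `x_A − y_s`, and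
`⟨ξ₁ − ξ₂, x_A − x_s⟩ ≥ 0`, then `(x_s, y_s)` shields `x_A` from `y_B`. -/
theorem subgradient_condition_implies_shielding
    {E : Type*} [NormedAddCommGroup E] [InnerProductSpace ℝ E]
    (h : E → ℝ)
    (hconv : ∀ z₁ z₂ : E, z₁ ≠ z₂ → ∀ t : ℝ, t ∈ Set.Ioo (0 : ℝ) 1 →
      h (t • z₁ + (1 - t) • z₂) < t * h z₁ + (1 - t) * h z₂)
    (xA xs ys yB : E) (hne : xA ≠ xs)
    (ξ₁ ξ₂ : E)
    (hξ₁ : ∀ z, h z ≥ h (xs - yB) + ⟪ξ₁, z - (xs - yB)⟫)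
    (hξ₂ : ∀ z, h z ≥ h (xA - ys) + ⟪ξ₂, z - (xA - ys)⟫)
    (hip : ⟪ξ₁ - ξ₂, xA - xs⟫ ≥ 0) :
    h (xA - yB) - h (xs - yB) > h (xA - ys) - h (xs - ys) := by
  have h₁ := subgradient_lt_of_strictly_convex hconv hξ₁
    (z := xA - yB) (fun heq => hne (sub_left_injective heq))
  have h₂ := hξ₂ (xs - ys)
  rw [sub_sub_sub_cancel_right] at h₁ h₂
  rw [← neg_sub xA xs, inner_neg_right] at h₂
  rw [inner_sub_left] at hip
  linarith
end

section
/- Let (X,d) be a metric space, Y any set, and let c_geo, c_n, c_L : X × Y → ℝ be functions such that 0 ≤ c_n(x,y) ≤ 1 for all (x,y) and |c_L(x₁,y) − c_L(x₂,y)| ≤ d(x₁,x₂) for all x₁, x₂ ∈ X and y ∈ Y (1-Lipschitz in the first argument). Let η, λ ≥ 0 and set c = c_geo + η·c_n + λ·c_L. If points x_A, x_s ∈ X and y_s, y_B ∈ Y satisfy [c_geo(x_A,y_B) − c_geo(x_s,y_B)] − [c_geo(x_A,y_s) − c_geo(x_s,y_s)] > 2η + 2λ·d(x_A,x_s), then (x_s,y_s)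 shields x_A from y_B with respect to the cost c, i.e. c(x_A,y_B) − c(x_s,y_B) > c(x_A,y_s) − c(x_s,y_s). -/
/-- **Shielding for noisy cost functions.** Let
`c = c_geo + η·c_n + λ·c_L` where `0 ≤ c_n ≤ 1` and `c_L` is 1-Lipschitz in its first
argument. If the shielding margin of `c_geo` at `(x_A, (x_s, y_s), y_B)` exceeds
`2η + 2λ·d(x_A, x_s)`, then `(x_s, y_s)` shields `x_A` from `y_B` w.r.t. `c`. -/
theorem noisy_cost_shielding
    {X : Type*} [MetricSpace X] {Y : Type*}
    (cgeo cn cL : X → Y → ℝ)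
    (hcn : ∀ x y, cn x y ∈ Set.Icc (0 : ℝ) 1)
    (hcL : ∀ x₁ x₂ y, |cL x₁ y - cL x₂ y| ≤ dist x₁ x₂)
    (η lam : ℝ) (hη : 0 ≤ η) (hlam : 0 ≤ lam)
    (c : X → Y → ℝ)
    (hc : ∀ x y, c x y = cgeo x y + η * cn x y + lam * cL x y)
    (xA xs : X) (ys yB : Y)
    (hgeo : (cgeo xA yB - cgeo xs yB) - (cgeo xA ys - cgeo xs ys) >
      2 * η + 2 * lam * dist xA xs) :
    c xA yB - c xs yB > c xA ys - c xs ys := by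
  have noise : η * ((cn xA ys - cn xs ys) - (cn xA yB - cn xs yB)) ≤ η * 2 :=
    mul_le_mul_of_nonneg_left
      (by linarith [(hcn xA ys).2, (hcn xs ys).1, (hcn xA yB).1, (hcn xs yB).2]) hη
  have lipschitz :
      lam * ((cL xA ys - cL xs ys) - (cL xA yB - cL xs yB)) ≤ lam * (2 * dist xA xs) :=
    mul_le_mul_of_nonneg_left
      (by linarith [(abs_le.mp (hcL xA xs ys)).2, (abs_le.mp (hcL xA xs yB)).1]) hlam
  simp only [hc]
  linarith
end

section
/- Let E be a real inner product space, n ≥ 3, x₁,…,x_{n−1} ∈ E, v ∈ E, and real numbers t₁ < t₂ < ⋯ < t_{n−1} ≤ tₙ; set y_i = y₁ + t_i·v for i = 1,…,n (with y₁ ∈ E given, taking t₁ as the parameter of y₁). Suppose ⟨x_{i+1} − x_i, y_{i+1} − y_i⟩ ≥ 0 for i = 1,…,n−2. Then ‖x₁ − yₙ‖² ≥ ‖x₁ − y₂‖² + Σ_{i=2}^{n−1}(‖x_i − y_{i+1}‖² − ‖x_i − y_i‖²); that is, for the cost c(x,y) = ‖x − y‖², the tuple ((x₂,y₂),…,(x_{n−1},y_{n−1}))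 satisfies the short-cut inequality for (x₁,yₙ). -/
open scoped RealInnerProductSpace

/-- Moving the second argument of the squared distance from `p` to `q` costs less for the base
point `z` than for `w` as soon as `z - w` has nonnegative inner product with `q - p`. -/
lemma norm_sub_sq_sub_norm_sub_sq_le {E : Type*} [NormedAddCommGroup E] [InnerProductSpace ℝ E]
    {w z p q : E} (h : 0 ≤ ⟪z - w, q - p⟫) :
    ‖z - q‖ ^ 2 - ‖z - p‖ ^ 2 ≤ ‖w - q‖ ^ 2 - ‖w - p‖ ^ 2 := by
  simp only [norm_sub_sq_real, inner_sub_left, inner_sub_right] at h ⊢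
  linarith

/-- **Short-cuts along straight lines for the squared Euclidean distance
(Remark `rem:ShieldingEuclideanContinuous`).** Let `y_i = a + t_i • v` with
`t₁ < t₂ < ⋯ < t_{n-1} ≤ tₙ` (points on a straight line in monotone order). If
`⟨x_{i+1} − x_i, y_{i+1} − y_i⟩ ≥ 0` for `i = 1, …, n−2`, then the tuple
`((x₂,y₂), …, (x_{n-1},y_{n-1}))` satisfies the short-cut inequality for `(x₁, yₙ)`
w.r.t. `c(x, y) = ‖x − y‖²`. -/
theorem line_monotone_shortcut_inequality
    {E : Type*} [NormedAddCommGroup E] [InnerProductSpace ℝ E]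
    (n : ℕ) (hn : 3 ≤ n)
    (x : ℕ → E) (a v : E) (t : ℕ → ℝ)
    (y : ℕ → E) (hy : ∀ i, y i = a + t i • v)
    (hmono : ∀ i, 1 ≤ i → i ≤ n - 2 → t i < t (i + 1))
    (hlast : t (n - 1) ≤ t n)
    (hip : ∀ i, 1 ≤ i → i ≤ n - 2 → ⟪x (i + 1) - x i, y (i + 1) - y i⟫ ≥ 0) :
    ‖x 1 - y n‖ ^ 2 ≥ ‖x 1 - y 2‖ ^ 2 +
      ∑ i ∈ Finset.Icc 2 (n - 1), (‖x i - y (i + 1)‖ ^ 2 - ‖x i - y i‖ ^ 2) := by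
  have hdiff (i j : ℕ) : y i - y j = (t i - t j) • v := by
    rw [hy, hy, add_sub_add_left_eq_sub, sub_smul]
  have hinner (i : ℕ) (hi : 1 ≤ i) : i ≤ n - 1 → 0 ≤ ⟪x i - x 1, v⟫ := by
    induction i, hi using Nat.le_induction with
    | base => simp
    | succ i hi ih =>
      intro hin
      have hstep := hip i hi (by lia)
      rw [hdiff, real_inner_smul_right] at hstep
      have hpos := nonneg_of_mul_nonneg_right hstep (sub_pos.2 (hmono i hi (by lia)))
      rw [← sub_add_sub_cancel (x (i + 1)) (x i) (x 1), inner_add_left]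
      exact add_nonneg hpos (ih (by lia))
  have hle (i : ℕ) (hi : 2 ≤ i) (hin : i ≤ n - 1) : t i ≤ t (i + 1) := by
    rcases hin.eq_or_lt with rfl | hlt
    · rwa [Nat.sub_add_cancel (by lia)]
    · exact (hmono i (by lia) (by lia)).le
  have hsum : ∑ i ∈ Finset.Icc 2 (n - 1), (‖x i - y (i + 1)‖ ^ 2 - ‖x i - y i‖ ^ 2) ≤
      ∑ i ∈ Finset.Icc 2 (n - 1), (‖x 1 - y (i + 1)‖ ^ 2 - ‖x 1 - y i‖ ^ 2) := by
    refine Finset.sum_le_sum fun i hi => norm_sub_sq_sub_norm_sub_sq_le ?_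
    obtain ⟨hi, hin⟩ := Finset.mem_Icc.1 hi
    rw [hdiff, real_inner_smul_right]
    exact mul_nonneg (sub_nonneg.2 (hle i hi hin)) (hinner i (by lia) hin)
  have htel : ∑ i ∈ Finset.Icc 2 (n - 1), (‖x 1 - y (i + 1)‖ ^ 2 - ‖x 1 - y i‖ ^ 2) =
      ‖x 1 - y n‖ ^ 2 - ‖x 1 - y 2‖ ^ 2 := by
    rw [show Finset.Icc 2 (n - 1) = Finset.Ico 2 n by
      ext i; simp only [Finset.mem_Icc, Finset.mem_Ico]; lia]
    exact Finset.sum_Ico_sub (fun i => ‖x 1 - y i‖ ^ 2) (by lia)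
  linarith
end

section
/- Let F(θ,φ) = (sin θ · cos φ, sin θ · sin φ, cos θ) denote spherical coordinates on the unit sphere S² ⊂ ℝ³, and let d(x,y) = arccos(⟨x,y⟩) be the geodesic distance between unit vectors x, y. Let θ_B ∈ (0,π), φ_B ∈ ℝ, and 0 ≤ r ≤ π/2 with cos²r > cos²θ_B. Then every point y' = F(θ',φ') with θ' ∈ [0,π], φ' ∈ ℝ and d(y', F(θ_B,φ_B)) ≤ r satisfies |θ' − θ_B| ≤ r and cos(φ' − φ_B) ≥ √((cos²r − cos²θ_B)/(1 − cos²θ_B)); i.e. the closed geodesic ball of radius r around F(θ_B,φ_B) is contained in the spherical-coordinate rectangle [θ_B − r, θ_B + r] × [φ_B − φ̂, φ_B + φ̂] with φ̂ = arccos(√((cos²r − cos²θ_B)/(1 − cos²θ_B))). -/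
open scoped RealInnerProductSpace

/-- Spherical coordinates `F(θ, φ) = (sin θ cos φ, sin θ sin φ, cos θ)` on the unit
sphere `S² ⊂ ℝ³`. -/
noncomputable def sphCoord (θ φ : ℝ) : EuclideanSpace ℝ (Fin 3) :=
  (WithLp.equiv 2 (Fin 3 → ℝ)).symm
    ![Real.sin θ * Real.cos φ, Real.sin θ * Real.sin φ, Real.cos θ]

/-- Geodesic distance `d(x, y) = arccos ⟨x, y⟩` between unit vectors in `ℝ³`. -/
noncomputable def sphDist (x y : EuclideanSpace ℝ (Fin 3)) : ℝ :=
  Real.arccos ⟪x, y⟫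

/-- The inner product of two points of the sphere in spherical coordinates. -/
theorem inner_sphCoord (θ φ θ₀ φ₀ : ℝ) :
    ⟪sphCoord θ φ, sphCoord θ₀ φ₀⟫ =
      Real.sin θ * Real.sin θ₀ * Real.cos (φ - φ₀) + Real.cos θ * Real.cos θ₀ := by
  simp only [sphCoord, PiLp.inner_apply, Fin.sum_univ_three, Real.cos_sub]
  simp
  ring

theorem cos_le_of_arccos_le {x r : ℝ} (hr : r ≤ Real.pi / 2) (h : Real.arccos x ≤ r) :
    Real.cos r ≤ x := by
  have hx0 : 0 ≤ x := Real.arccos_le_pi_div_two.mp (h.trans hr)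
  rcases le_total x 1 with hx1 | hx1
  · rw [← Real.cos_arccos (by linarith) hx1]
    exact Real.cos_le_cos_of_nonneg_of_le_pi (Real.arccos_nonneg x)
      (by linarith [Real.pi_pos]) h
  · exact (Real.cos_le_one r).trans hx1

/-- **Geodesic balls are contained in spherical-coordinate rectangles.**
Let `θ_B ∈ (0, π)`, `0 ≤ r ≤ π/2` with `cos² r > cos² θ_B`. Then every point
`y' = F(θ', φ')` with `θ' ∈ [0, π]` and `d(y', F(θ_B, φ_B)) ≤ r` satisfies
`|θ' − θ_B| ≤ r` and `cos(φ' − φ_B) ≥ √((cos² r − cos² θ_B) / (1 − cos² θ_B))`,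
i.e. the closed geodesic ball of radius `r` around `F(θ_B, φ_B)` is contained in the
rectangle `[θ_B − r, θ_B + r] × [φ_B − φ̂, φ_B + φ̂]` with
`φ̂ = arccos √((cos² r − cos² θ_B) / (1 − cos² θ_B))`. -/
theorem geodesic_ball_subset_spherical_rectangle
    (θB φB r : ℝ) (hθB : θB ∈ Set.Ioo 0 Real.pi)
    (hr0 : 0 ≤ r) (hrπ : r ≤ Real.pi / 2)
    (hcos : Real.cos θB ^ 2 < Real.cos r ^ 2)
    (θ' φ' : ℝ) (hθ' : θ' ∈ Set.Icc 0 Real.pi)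
    (hd : sphDist (sphCoord θ' φ') (sphCoord θB φB) ≤ r) :
    |θ' - θB| ≤ r ∧
      Real.cos (φ' - φB) ≥
        Real.sqrt ((Real.cos r ^ 2 - Real.cos θB ^ 2) / (1 - Real.cos θB ^ 2)) := by
  rw [sphDist, inner_sphCoord] at hd
  have hle := cos_le_of_arccos_le hrπ hd
  have hs' : 0 ≤ Real.sin θ' := Real.sin_nonneg_of_mem_Icc hθ'
  have hsB : 0 < Real.sin θB := Real.sin_pos_of_mem_Ioo hθB
  have hss : 0 ≤ Real.sin θ' * Real.sin θB := mul_nonneg hs' hsB.le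
  refine ⟨?_, ?_⟩
  · have hcos_le : Real.cos r ≤ Real.cos |θ' - θB| := by
      rw [Real.cos_abs, Real.cos_sub]
      linarith [mul_le_mul_of_nonneg_left (Real.cos_le_one (φ' - φB)) hss]
    by_contra! hlt
    have habs : |θ' - θB| ≤ Real.pi := by
      rw [abs_le]
      constructor <;> linarith [hθ'.1, hθ'.2, hθB.1, hθB.2]
    exact (Real.cos_lt_cos_of_nonneg_of_le_pi hr0 habs hlt).not_ge hcos_le
  · have hr_cos : 0 ≤ Real.cos r :=
      Real.cos_nonneg_of_neg_pi_div_two_le_of_le (by linarith [Real.pi_pos]) hrπ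
    have hcB : |Real.cos θB| < Real.cos r := abs_lt_of_sq_lt_sq hcos hr_cos
    have hcc : Real.cos θ' * Real.cos θB ≤ |Real.cos θB| := by
      refine (le_abs_self _).trans ?_
      rw [abs_mul]
      exact mul_le_of_le_one_left (abs_nonneg _) (Real.abs_cos_le_one θ')
    have hpos : 0 < Real.cos (φ' - φB) :=
      pos_of_mul_pos_right (by linarith) hss
    have hsq : Real.cos r ^ 2 ≤
        (Real.sin θB * Real.cos (φ' - φB)) ^ 2 + Real.cos θB ^ 2 := by
      refine (pow_le_pow_left₀ hr_cos hle 2).trans ?_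
      have h1 := Real.sin_sq_add_cos_sq θ'
      generalize Real.cos (φ' - φB) = c at *
      have key : (Real.sin θ' * Real.sin θB * c + Real.cos θ' * Real.cos θB) ^ 2 +
          (Real.sin θ' * Real.cos θB - Real.cos θ' * (Real.sin θB * c)) ^ 2 =
          (Real.sin θB * c) ^ 2 + Real.cos θB ^ 2 := by
        linear_combination ((Real.sin θB * c) ^ 2 + Real.cos θB ^ 2) * h1
      linarith [sq_nonneg (Real.sin θ' * Real.cos θB - Real.cos θ' * (Real.sin θB * c))]
    rw [ge_iff_le, Real.sqrt_le_left hpos.le, ← Real.sin_sq, div_le_iff₀ (by positivity)]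
    linarith [mul_pow (Real.sin θB) (Real.cos (φ' - φB)) 2]
end
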